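/- Let Ω ⊂ ℝ^n be a bounded open set and let V ∈ C_0^∞(Ω) be real-valued. Then 𝒫_4(V) = ((4π)^{-n/2} / 2) ∫_Ω V(x)² dx. -/

import Mathlib

open MeasureTheory Real

noncomputable def heatG (n : ℕ) (t : ℝ) (x : EuclideanSpace ℝ (Fin n)) : ℝ :=
  (4 * Real.pi * t) ^ (-(n : ℝ) / 2) * Real.exp (-‖x‖ ^ 2 / (4 * t))

/-- The simplex `{0 < s_m < … < s_1 < 1}` (indices listed in decreasing order). -/
def simplex (m : ℕ) : Set (Fin m → ℝ) :=
  {s | StrictAnti s ∧ ∀ k, s k ∈ Set.Ioo (0 : ℝ) 1}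

/-- `fnext s k = s (k+1)`, with the convention that it is `0` past the last index. -/
def fnext {m : ℕ} {E : Type*} [Zero E] (s : Fin m → E) (k : Fin m) : E :=
  if h : (k : ℕ) + 1 < m then s ⟨(k : ℕ) + 1, h⟩ else 0

/-- The coefficient `c_{αʲ}` associated with a `(j+1)`-tuple `α` of multi-indices in `ℕⁿ`
(a tuple of length `j+1`, so that tuples of every length `≥ 1` are covered). -/
noncomputable def cCoeff (n j : ℕ) (α : Fin (j + 1) → Fin n → ℕ) : ℝ :=
  (∏ k, ∏ i, (Nat.factorial (α k i) : ℝ))⁻¹ *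
    ∫ w : Fin (j + 1) → EuclideanSpace ℝ (Fin n),
      ∫ s in simplex (j + 1),
        (∏ k, ∏ i, w k i ^ α k i) *
          (heatG n (1 - s 0) (w 0) *
            ∏ k, heatG n (s k - fnext s k) (w k - fnext w k))

/-- Partial derivative in the `i`-th coordinate direction. -/
noncomputable def pderiv1 {n : ℕ} (i : Fin n) (f : EuclideanSpace ℝ (Fin n) → ℝ) :
    EuclideanSpace ℝ (Fin n) → ℝ :=
  fun x => fderiv ℝ f x (EuclideanSpace.single i 1)

/-- The multi-index partial derivative `∂^α f`. -/
noncomputable def mderiv {n : ℕ} (α : Fin n → ℕ) (f : EuclideanSpace ℝ (Fin n) → ℝ) :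
    EuclideanSpace ℝ (Fin n) → ℝ :=
  ((List.ofFn fun i : Fin n => (pderiv1 i)^[α i]).foldr (· ∘ ·) id) f

/-- `P_{αʲ}(V) = ∫_Ω ∏_k ∂^{α_k} V`. -/
noncomputable def Pcoef (n j : ℕ) (Ω : Set (EuclideanSpace ℝ (Fin n)))
    (α : Fin (j + 1) → Fin n → ℕ) (V : EuclideanSpace ℝ (Fin n) → ℝ) : ℝ :=
  ∫ x in Ω, ∏ k, mderiv (α k) V x

/-- `P_{2ℓ}(V) = Σ_{j=1}^{ℓ} (-1)^j Σ_{|αʲ| = 2ℓ-2j} c_{αʲ} P_{αʲ}(V)`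
(the inner sum, over the finitely many tuples of multi-indices of total order `2ℓ-2j`,
is written as a `tsum` over all tuples with an indicator). -/
noncomputable def Pscr (n : ℕ) (Ω : Set (EuclideanSpace ℝ (Fin n))) (ℓ : ℕ)
    (V : EuclideanSpace ℝ (Fin n) → ℝ) : ℝ :=
  ∑ m ∈ Finset.range ℓ,
    (-1 : ℝ) ^ (m + 1) *
      ∑' α : Fin (m + 1) → Fin n → ℕ,
        if (∑ k, ∑ i, α k i) = 2 * ℓ - 2 * (m + 1) then
          cCoeff n m α * Pcoef n m Ω α V else 0

section HeatKernel

variable {n : ℕ}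

theorem continuous_heatG (t : ℝ) : Continuous (heatG n t) := by
  unfold heatG
  fun_prop

theorem measurable_heatG : Measurable fun p : ℝ × EuclideanSpace ℝ (Fin n) => heatG n p.1 p.2 := by
  unfold heatG
  fun_prop

theorem heatG_nonneg {t : ℝ} (ht : 0 ≤ t) (x : EuclideanSpace ℝ (Fin n)) : 0 ≤ heatG n t x := by
  unfold heatG
  positivity

theorem integral_heatG {t : ℝ} (ht : 0 < t) : ∫ x, heatG n t x = 1 := by
  have h := GaussianFourier.integral_rexp_neg_mul_sq_norm
    (V := EuclideanSpace ℝ (Fin n)) (b := (4 * t)⁻¹) (by positivity)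
  have h' : ∀ x : EuclideanSpace ℝ (Fin n),
      -‖x‖ ^ 2 / (4 * t) = -(4 * t)⁻¹ * ‖x‖ ^ 2 := fun x => by ring
  simp only [heatG, integral_const_mul, h', h, finrank_euclideanSpace_fin]
  rw [div_inv_eq_mul, show π * (4 * t) = 4 * π * t by ring, ← rpow_add (by positivity),
    neg_div, neg_add_cancel, rpow_zero]

theorem integrable_heatG {t : ℝ} (ht : 0 < t) : Integrable (heatG n t) :=
  .of_integral_ne_zero (by simp [integral_heatG ht])

/-- Completing the square in a product of two heat kernels. -/
theorem heatG_sub_mul_heatG {a b : ℝ} (ha : 0 < a) (hb : 0 < b)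
    (x y : EuclideanSpace ℝ (Fin n)) :
    heatG n a (x - y) * heatG n b y =
      heatG n (a + b) x * heatG n (a * b / (a + b)) (y - (b / (a + b)) • x) := by
  have hab : 0 < a + b := by positivity
  have hexp : -‖x - y‖ ^ 2 / (4 * a) + -‖y‖ ^ 2 / (4 * b) =
      -‖x‖ ^ 2 / (4 * (a + b)) +
        -‖y - (b / (a + b)) • x‖ ^ 2 / (4 * (a * b / (a + b))) := by
    rw [norm_sub_sq_real, norm_sub_sq_real, norm_smul, mul_pow, inner_smul_right,
      real_inner_comm x y, norm_eq_abs, sq_abs]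
    field_simp
    ring
  unfold heatG
  rw [mul_mul_mul_comm, mul_mul_mul_comm _ (rexp _) _ (rexp _), ← exp_add, ← exp_add, hexp,
    ← mul_rpow (by positivity) (by positivity), ← mul_rpow (by positivity) (by positivity)]
  congr 2
  field_simp

theorem heatG_neg (t : ℝ) (x : EuclideanSpace ℝ (Fin n)) : heatG n t (-x) = heatG n t x := by
  simp [heatG]

/-- The heat loop of length `1` through two intermediate points, as a product of a constant and
two normalized Gaussians. -/
theorem heatG_loop_eq {s t : ℝ} (hs : s < 1) (hts : t < s) (ht : 0 < t)
    (x y : EuclideanSpace ℝ (Fin n)) :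
    heatG n (1 - s) x * (heatG n (s - t) (x - y) * heatG n t y) =
      heatG n 1 0 * heatG n ((1 - s) * s) x *
        heatG n ((s - t) * t / s) (y - (t / s) • x) := by
  have h₁ := heatG_sub_mul_heatG (sub_pos.2 hts) ht x y
  have h₂ := heatG_sub_mul_heatG (sub_pos.2 hs) (ht.trans hts) 0 x
  simp only [sub_add_cancel, zero_sub, heatG_neg, smul_zero, sub_zero, div_one] at h₁ h₂
  rw [h₁, ← mul_assoc, h₂]

theorem integral_heatG_sub {t : ℝ} (ht : 0 < t) (z : EuclideanSpace ℝ (Fin n)) :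
    ∫ y, heatG n t (y - z) = 1 := by
  rw [integral_sub_right_eq_self (heatG n t), integral_heatG ht]

theorem integrable_heatG_loop {s t : ℝ} (hs : s < 1) (hts : t < s) (ht : 0 < t) :
    Integrable fun p : EuclideanSpace ℝ (Fin n) × EuclideanSpace ℝ (Fin n) =>
      heatG n (1 - s) p.1 * (heatG n (s - t) (p.1 - p.2) * heatG n t p.2) := by
  have hs0 : 0 < s := ht.trans hts
  have hst : 0 < (s - t) * t / s := div_pos (mul_pos (sub_pos.2 hts) ht) hs0
  have hss : 0 < (1 - s) * s := mul_pos (sub_pos.2 hs) hs0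
  simp only [heatG_loop_eq hs hts ht]
  refine (integrable_prod_iff ?_).2 ⟨.of_forall fun x => ?_, ?_⟩
  · have h₁ := continuous_heatG (n := n) ((1 - s) * s)
    have h₂ := continuous_heatG (n := n) ((s - t) * t / s)
    exact Continuous.aestronglyMeasurable (by fun_prop)
  · have h := (integrable_heatG hst).comp_sub_right ((t / s) • x)
    exact h.const_mul (heatG n 1 0 * heatG n ((1 - s) * s) x)
  · have h : ∀ x y : EuclideanSpace ℝ (Fin n),
        ‖heatG n 1 0 * heatG n ((1 - s) * s) x * heatG n ((s - t) * t / s) (y - (t / s) • x)‖ =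
          heatG n 1 0 * heatG n ((1 - s) * s) x * heatG n ((s - t) * t / s) (y - (t / s) • x) :=
      fun x y => norm_of_nonneg (mul_nonneg (mul_nonneg (heatG_nonneg zero_le_one _)
        (heatG_nonneg hss.le _)) (heatG_nonneg hst.le _))
    simp only [h, integral_const_mul, integral_heatG_sub hst, mul_one]
    exact (integrable_heatG hss).const_mul _

theorem integral_heatG_loop {s t : ℝ} (hs : s < 1) (hts : t < s) (ht : 0 < t) :
    ∫ p : EuclideanSpace ℝ (Fin n) × EuclideanSpace ℝ (Fin n),
      heatG n (1 - s) p.1 * (heatG n (s - t) (p.1 - p.2) * heatG n t p.2) = heatG n 1 0 := by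
  have hs0 : 0 < s := ht.trans hts
  have hst : 0 < (s - t) * t / s := div_pos (mul_pos (sub_pos.2 hts) ht) hs0
  have hss : 0 < (1 - s) * s := mul_pos (sub_pos.2 hs) hs0
  rw [Measure.volume_eq_prod, integral_prod _ (integrable_heatG_loop hs hts ht)]
  simp only [heatG_loop_eq hs hts ht, integral_const_mul, integral_heatG_sub hst, mul_one,
    integral_heatG hss]

end HeatKernel

section Simplex

theorem simplex_two_eq_preimage :
    simplex 2 = MeasurableEquiv.finTwoArrow ⁻¹'
      regionBetween (fun _ => (0 : ℝ)) (fun x => x) (Set.Ioo 0 1) := by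
  ext s
  simp only [simplex, Fin.strictAnti_iff_succ_lt, Fin.forall_fin_two, regionBetween,
    Set.mem_preimage, Set.mem_ofPred_eq, Set.mem_Ioo, MeasurableEquiv.finTwoArrow_apply]
  simp
  constructor
  · rintro ⟨h, ⟨h₁, h₂⟩, h₃, h₄⟩
    exact ⟨⟨h₁, h₂⟩, h₃, h⟩
  · rintro ⟨⟨h₁, h₂⟩, h₃, h⟩
    exact ⟨h, ⟨h₁, h₂⟩, h₃, h.trans h₂⟩

theorem measurableSet_simplex_two : MeasurableSet (simplex 2) := by
  rw [simplex_two_eq_preimage]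
  exact MeasurableEquiv.finTwoArrow.measurable
    (measurableSet_regionBetween measurable_const measurable_id measurableSet_Ioo)

theorem volume_simplex_two : volume (simplex 2) = ENNReal.ofReal (1 / 2) := by
  have hm : MeasurableSet (regionBetween (fun _ => (0 : ℝ)) (fun x => x) (Set.Ioo 0 1)) :=
    measurableSet_regionBetween measurable_const measurable_id measurableSet_Ioo
  rw [simplex_two_eq_preimage, (volume_preserving_finTwoArrow ℝ).measure_preimage
    hm.nullMeasurableSet, Measure.volume_eq_prod,
    volume_regionBetween_eq_integral]
  · congr 1
    rw [← integral_Ioc_eq_integral_Ioo, ← intervalIntegral.integral_of_le zero_le_one]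
    simp
  · simp
  · exact continuous_id.integrableOn_Icc.mono_set Set.Ioo_subset_Icc_self
  · exact measurableSet_Ioo
  · exact fun x hx => hx.1.le

end Simplex

section Coefficient

/-- The integrand of the coefficient `c_{(0,0)}`. -/
noncomputable def heatLoop (n : ℕ) (w : Fin 2 → EuclideanSpace ℝ (Fin n)) (s : Fin 2 → ℝ) : ℝ :=
  heatG n (1 - s 0) (w 0) * (heatG n (s 0 - s 1) (w 0 - w 1) * heatG n (s 1) (w 1))

variable {n : ℕ}

theorem mem_simplex_two {s : Fin 2 → ℝ} (hs : s ∈ simplex 2) : s 0 < 1 ∧ s 1 < s 0 ∧ 0 < s 1 :=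
  ⟨(hs.2 0).2, hs.1 Fin.zero_lt_one, (hs.2 1).1⟩

theorem integrable_heatLoop {s : Fin 2 → ℝ} (hs : s ∈ simplex 2) :
    Integrable fun w => heatLoop n w s := by
  obtain ⟨h₁, h₂, h₃⟩ := mem_simplex_two hs
  exact (volume_preserving_finTwoArrow _).integrable_comp_of_integrable
    (integrable_heatG_loop h₁ h₂ h₃)

theorem integral_heatLoop {s : Fin 2 → ℝ} (hs : s ∈ simplex 2) :
    ∫ w, heatLoop n w s = heatG n 1 0 := by
  obtain ⟨h₁, h₂, h₃⟩ := mem_simplex_two hs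
  rw [← integral_heatG_loop h₁ h₂ h₃]
  exact (volume_preserving_finTwoArrow _).integral_comp' (fun p :
    EuclideanSpace ℝ (Fin n) × EuclideanSpace ℝ (Fin n) =>
      heatG n (1 - s 0) p.1 * (heatG n (s 0 - s 1) (p.1 - p.2) * heatG n (s 1) p.2))

theorem norm_heatLoop {s : Fin 2 → ℝ} (hs : s ∈ simplex 2)
    (w : Fin 2 → EuclideanSpace ℝ (Fin n)) : ‖heatLoop n w s‖ = heatLoop n w s := by
  obtain ⟨h₁, h₂, h₃⟩ := mem_simplex_two hs
  exact norm_of_nonneg (mul_nonneg (heatG_nonneg (sub_pos.2 h₁).le _)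
    (mul_nonneg (heatG_nonneg (sub_pos.2 h₂).le _) (heatG_nonneg h₃.le _)))

theorem measurable_heatLoop : Measurable (Function.uncurry (heatLoop n)) := by
  have hG : ∀ {f : (Fin 2 → EuclideanSpace ℝ (Fin n)) × (Fin 2 → ℝ) → ℝ}
      {g : (Fin 2 → EuclideanSpace ℝ (Fin n)) × (Fin 2 → ℝ) → EuclideanSpace ℝ (Fin n)},
      Measurable f → Measurable g → Measurable fun p => heatG n (f p) (g p) :=
    fun hf hg => measurable_heatG.comp (hf.prodMk hg)
  unfold heatLoop Function.uncurry
  exact (hG (by fun_prop) (by fun_prop)).mul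
    ((hG (by fun_prop) (by fun_prop)).mul (hG (by fun_prop) (by fun_prop)))

theorem integral_integral_heatLoop :
    ∫ w, ∫ s in simplex 2, heatLoop n w s = heatG n 1 0 / 2 := by
  have hfin : IsFiniteMeasure (volume.restrict (simplex 2)) :=
    ⟨by simp [volume_simplex_two]⟩
  have hmem : ∀ᵐ s ∂volume.restrict (simplex 2), s ∈ simplex 2 :=
    ae_restrict_mem measurableSet_simplex_two
  have hint : Integrable (Function.uncurry (heatLoop n))
      (volume.prod (volume.restrict (simplex 2))) := by
    refine (integrable_prod_iff' measurable_heatLoop.aestronglyMeasurable).2 ⟨?_, ?_⟩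
    · filter_upwards [hmem] with s hs using integrable_heatLoop hs
    · refine (integrable_const (heatG n 1 0)).congr ?_
      filter_upwards [hmem] with s hs
      simp only [Function.uncurry_apply_pair, norm_heatLoop hs, integral_heatLoop hs]
  rw [integral_integral_swap hint,
    setIntegral_congr_fun measurableSet_simplex_two fun s hs => integral_heatLoop hs,
    setIntegral_const, measureReal_def, volume_simplex_two, ENNReal.toReal_ofReal (by norm_num),
    smul_eq_mul]
  ring

theorem cCoeff_one_zero : cCoeff n 1 0 = (4 * π) ^ (-(n : ℝ) / 2) / 2 := by
  have h : ∀ (w : Fin 2 → EuclideanSpace ℝ (Fin n)) (s : Fin 2 → ℝ),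
      (∏ k, ∏ i, w k i ^ (0 : Fin 2 → Fin n → ℕ) k i) *
        (heatG n (1 - s 0) (w 0) * ∏ k, heatG n (s k - fnext s k) (w k - fnext w k)) =
      heatLoop n w s := by
    intro w s
    simp [heatLoop, fnext, Fin.prod_univ_two]
  have hG : heatG n 1 0 = (4 * π) ^ (-(n : ℝ) / 2) := by simp [heatG]
  unfold cCoeff
  simp only [Nat.reduceAdd, h, integral_integral_heatLoop, hG]
  simp

end Coefficient

section Derivatives

variable {n : ℕ}

/-- The class of smooth compactly supported functions with support in `Ω`. -/
structure IsTestFunctionOn (Ω : Set (EuclideanSpace ℝ (Fin n)))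
    (f : EuclideanSpace ℝ (Fin n) → ℝ) : Prop where
  contDiff : ContDiff ℝ (⊤ : ℕ∞) f
  hasCompactSupport : HasCompactSupport f
  tsupport_subset : tsupport f ⊆ Ω

variable {Ω : Set (EuclideanSpace ℝ (Fin n))} {f : EuclideanSpace ℝ (Fin n) → ℝ}

theorem IsTestFunctionOn.pderiv1 (hf : IsTestFunctionOn Ω f) (i : Fin n) :
    IsTestFunctionOn Ω (pderiv1 i f) where
  contDiff := (hf.contDiff.fderiv_right (m := (⊤ : ℕ∞)) (by simp)).clm_apply contDiff_const
  hasCompactSupport := hf.hasCompactSupport.fderiv_apply ℝ _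
  tsupport_subset := (tsupport_fderiv_apply_subset ℝ _).trans hf.tsupport_subset

theorem IsTestFunctionOn.iterate_pderiv1 (hf : IsTestFunctionOn Ω f) (i : Fin n) (k : ℕ) :
    IsTestFunctionOn Ω ((_root_.pderiv1 i)^[k] f) := by
  induction k with
  | zero => exact hf
  | succ k ih =>
    rw [Function.iterate_succ_apply']
    exact ih.pderiv1 i

theorem IsTestFunctionOn.integrable (hf : IsTestFunctionOn Ω f) : Integrable f :=
  hf.contDiff.continuous.integrable_of_hasCompactSupport hf.hasCompactSupport

theorem IsTestFunctionOn.setIntegral_pderiv1 (hf : IsTestFunctionOn Ω f) (i : Fin n) :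
    ∫ x in Ω, _root_.pderiv1 i f x = 0 := by
  have hi := hf.pderiv1 i
  rw [setIntegral_eq_integral_of_forall_compl_eq_zero fun x hx =>
    image_eq_zero_of_notMem_tsupport fun h => hx (hi.tsupport_subset h)]
  have h := integral_mul_fderiv_eq_neg_fderiv_mul_of_integrable
    (μ := (volume : Measure (EuclideanSpace ℝ (Fin n)))) (𝕜 := ℝ) (f := fun _ => (1 : ℝ)) (g := f)
    (v := EuclideanSpace.single i 1) (by simp) (by simpa using! hi.integrable)
    (by simpa using hf.integrable) (fun _ _ => differentiableAt_const _)
    (fun x _ => (hf.contDiff.differentiable (by simp)) x)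
  simpa using! h

theorem IsTestFunctionOn.setIntegral_foldr_pderiv1 (hf : IsTestFunctionOn Ω f)
    (α : Fin n → ℕ) (l : List (Fin n)) :
    IsTestFunctionOn Ω
        (((l.map fun i => (_root_.pderiv1 i)^[α i]).foldr (· ∘ ·) id) f) ∧
      ((∃ i ∈ l, α i ≠ 0) →
        ∫ x in Ω, ((l.map fun i => (_root_.pderiv1 i)^[α i]).foldr (· ∘ ·) id) f x = 0) := by
  induction l with
  | nil => simpa using hf
  | cons i l ih =>
    simp only [List.map_cons, List.foldr_cons, Function.comp_apply]
    refine ⟨ih.1.iterate_pderiv1 i _, fun h => ?_⟩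
    rcases hαi : α i with _ | k
    · refine ih.2 ?_
      simpa [hαi] using h
    · rw [Function.iterate_succ_apply']
      exact (ih.1.iterate_pderiv1 i k).setIntegral_pderiv1 i

theorem IsTestFunctionOn.setIntegral_mderiv (hf : IsTestFunctionOn Ω f) {α : Fin n → ℕ}
    (hα : ∑ i, α i ≠ 0) : ∫ x in Ω, mderiv α f x = 0 := by
  obtain ⟨i, -, hi⟩ := Finset.exists_ne_zero_of_sum_ne_zero hα
  unfold mderiv
  rw [List.ofFn_eq_map]
  exact (hf.setIntegral_foldr_pderiv1 α _).2 ⟨i, List.mem_finRange i, hi⟩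

theorem mderiv_zero : mderiv 0 f = f := by
  unfold mderiv
  rw [List.ofFn_eq_map]
  induction List.finRange n with
  | nil => rfl
  | cons i l ih => simpa using ih

end Derivatives

theorem Pscr_four (n : ℕ) (Ω : Set (EuclideanSpace ℝ (Fin n)))
    (hΩ : IsOpen Ω) (hbdd : Bornology.IsBounded Ω)
    (V : EuclideanSpace ℝ (Fin n) → ℝ) (hV : ContDiff ℝ (⊤ : ℕ∞) V)
    (hcpt : HasCompactSupport V) (hsupp : tsupport V ⊆ Ω) :
    Pscr n Ω 2 V = (4 * Real.pi) ^ (-(n : ℝ) / 2) / 2 * ∫ x in Ω, V x ^ 2 := by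
  have hVΩ : IsTestFunctionOn Ω V := ⟨hV, hcpt, hsupp⟩
  have h₀ : ∀ α : Fin (0 + 1) → Fin n → ℕ,
      (if (∑ k, ∑ i, α k i) = 2 * 2 - 2 * (0 + 1) then
        cCoeff n 0 α * Pcoef n 0 Ω α V else 0) = 0 := by
    intro α
    split_ifs with h
    · have hα : ∑ i, α 0 i ≠ 0 := by
        rw [Fin.sum_univ_one] at h
        omega
      have hP : Pcoef n 0 Ω α V = 0 := by
        simpa [Pcoef] using hVΩ.setIntegral_mderiv hα
      rw [hP, mul_zero]
    · rfl
  have h₁ : ∀ α : Fin (1 + 1) → Fin n → ℕ, α ≠ 0 →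
      (if (∑ k, ∑ i, α k i) = 2 * 2 - 2 * (1 + 1) then
        cCoeff n 1 α * Pcoef n 1 Ω α V else 0) = 0 := by
    intro α hα
    refine if_neg fun h => hα ?_
    ext k i
    simp only [Nat.reduceMul, Nat.reduceAdd, Nat.sub_self, Finset.sum_eq_zero_iff] at h
    exact h k (Finset.mem_univ k) i (Finset.mem_univ i)
  have hP : Pcoef n 1 Ω 0 V = ∫ x in Ω, V x ^ 2 := by
    simp [Pcoef, mderiv_zero, sq]
  unfold Pscr
  rw [Finset.sum_range_succ, Finset.sum_range_one, tsum_congr h₀, tsum_eq_single 0 h₁,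
    cCoeff_one_zero, hP]
  simp
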